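/- (Soundness of the compilation.) If a plan π solves the compiled problem P_mod (i.e., π is executable from I_mod in P_mod and its resulting state contains G_mod), then π solves the robot's problem P_R and π solves the human's problem P_H. -/

import Mathlib

/-- A STRIPS planning problem over fluents `F` and actions `A`. -/
structure Problem (F : Type) (A : Type) where
  pre : A → Set F
  add : A → Set F
  del : A → Set F
  I : Set F
  G : Set F

/-- Applying action `a` in state `s`. -/
def applyAct {F A : Type} (P : Problem F A) (s : Set F) (a : A) : Set F :=
  (s ∪ P.add a) \ P.del a

/-- A plan is executable from a state iff each action's precondition holds
in the state obtained by applying the preceding actions. -/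
def Executable {F A : Type} (P : Problem F A) : Set F → List A → Prop
  | _, [] => True
  | s, a :: rest => P.pre a ⊆ s ∧ Executable P (applyAct P s a) rest

/-- The resulting state of a plan from a state. -/
def result {F A : Type} (P : Problem F A) : Set F → List A → Set F
  | s, [] => s
  | s, a :: rest => result P (applyAct P s a) rest

/-- A plan solves a problem iff it is executable from the initial state and
its resulting state contains the goal. -/
def Solves {F A : Type} (P : Problem F A) (π : List A) : Prop :=
  Executable P P.I π ∧ P.G ⊆ result P P.I π

/-- Tagged union of two states: `s_R ⊎ s_H ⊆ F ⊕ F`. -/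
def tagUnion {F : Type} (sR sH : Set F) : Set (F ⊕ F) :=
  Sum.inl '' sR ∪ Sum.inr '' sH

/-- The compiled problem `P_mod` over `F ⊕ F`. -/
def compiled {F A : Type} (PR PH : Problem F A) : Problem (F ⊕ F) A where
  pre a := tagUnion (PR.pre a) (PH.pre a)
  add a := tagUnion (PR.add a) (PH.add a)
  del a := tagUnion (PR.del a) (PH.del a)
  I := tagUnion PR.I PH.I
  G := tagUnion PR.G PH.G

theorem tagUnion_subset_iff {F : Type} (a b c d : Set F) :
    tagUnion a b ⊆ tagUnion c d ↔ a ⊆ c ∧ b ⊆ d := by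
  constructor
  · intro h
    refine ⟨fun x hx => ?_, fun x hx => ?_⟩
    · simpa [tagUnion] using h (Or.inl ⟨x, hx, rfl⟩)
    · simpa [tagUnion] using h (Or.inr ⟨x, hx, rfl⟩)
  · rintro ⟨h1, h2⟩
    exact Set.union_subset_union (Set.image_mono h1) (Set.image_mono h2)

theorem applyAct_compiled {F A : Type} (PR PH : Problem F A) (sR sH : Set F) (a : A) :
    applyAct (compiled PR PH) (tagUnion sR sH) a
      = tagUnion (applyAct PR sR a) (applyAct PH sH a) := by
  ext x
  cases x <;> simp [applyAct, compiled, tagUnion]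

theorem compiled_run {F A : Type} (PR PH : Problem F A) (π : List A) :
    ∀ sR sH : Set F,
      (Executable (compiled PR PH) (tagUnion sR sH) π →
        Executable PR sR π ∧ Executable PH sH π) ∧
      result (compiled PR PH) (tagUnion sR sH) π
        = tagUnion (result PR sR π) (result PH sH π) := by
  induction π with
  | nil => intro sR sH; simp [Executable, result]
  | cons a rest ih =>
    intro sR sH
    simp only [Executable, result, applyAct_compiled]
    refine ⟨?_, (ih _ _).2⟩
    rintro ⟨hp, he⟩
    obtain ⟨h1, h2⟩ := (tagUnion_subset_iff _ _ _ _).1 hp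
    obtain ⟨h3, h4⟩ := (ih _ _).1 he
    exact ⟨⟨h1, h3⟩, ⟨h2, h4⟩⟩

theorem stmt_3 {F A : Type} (PR PH : Problem F A) (π : List A)
    (h : Solves (compiled PR PH) π) : Solves PR π ∧ Solves PH π := by
  obtain ⟨he, hg⟩ := h
  obtain ⟨h1, h2⟩ := compiled_run PR PH π PR.I PH.I
  obtain ⟨e1, e2⟩ := h1 he
  have hg' : tagUnion PR.G PH.G ⊆ tagUnion (result PR PR.I π) (result PH PH.I π) :=
    h2 ▸ hg
  obtain ⟨g1, g2⟩ := (tagUnion_subset_iff _ _ _ _).1 hg'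
  exact ⟨⟨e1, g1⟩, ⟨e2, g2⟩⟩
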